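/- arXiv:2511.17272 — 7 statements merged into one kernel-verified Lean document; each statement's English description precedes it below -/
import Mathlib

section
/- Let F be a field and P a finite set of polynomials in F[x_1,...,x_n] that contains the Boolean axioms x_i^2 - x_i for every i in {1,...,n}. Then for every polynomial q in F[x_1,...,x_n], q vanishes at every common root in F^n of the polynomials in P if and only if q belongs to the ideal generated by P. In particular, 1 belongs to the ideal generated by P if and only if the polynomials in P have no common root in F^n. -/
open MvPolynomial in
/-- Modulo the Boolean axioms, multiplication by the indicator polynomial of a Boolean point
turns a polynomial into its value at that point. -/
theorem indicator_mul_sub_eval_mem {R σ : Type*} [CommRing R] [Fintype σ]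
    (I : Ideal (MvPolynomial σ R)) (hI : ∀ i, (X i ^ 2 - X i : MvPolynomial σ R) ∈ I)
    (b : σ → Bool) (f : MvPolynomial σ R) :
    (∏ i, if b i then X i else 1 - X i) * (f - C (eval (fun i => if b i then 1 else 0) f)) ∈ I := by
  classical
  set D : MvPolynomial σ R := ∏ i, if b i then X i else 1 - X i with hD
  induction f using MvPolynomial.induction_on with
  | C a => simp
  | add p q hp hq =>
    convert I.add_mem hp hq using 1
    simp only [map_add]
    ring
  | mul_X p i hp =>
    have hi : D * (X i - C (if b i then 1 else 0)) ∈ I := by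
      rw [hD, ← Finset.mul_prod_erase _ _ (Finset.mem_univ i), mul_right_comm]
      refine I.mul_mem_right _ ?_
      cases b i
      · convert I.neg_mem (hI i) using 1
        simp
        ring
      · convert hI i using 1
        simp
        ring
    convert I.add_mem (I.mul_mem_left (X i) hp) (I.mul_mem_left
      (C (eval (fun i => if b i then 1 else 0) p)) hi) using 1
    simp only [map_mul, eval_X]
    ring

open MvPolynomial in
/-- The indicator polynomials of the Boolean points sum to one. -/
theorem sum_indicator_eq_one {R σ : Type*} [CommRing R] [Fintype σ] [DecidableEq σ] :
    ∑ b : σ → Bool, ∏ i, (if b i then X i else 1 - X i : MvPolynomial σ R) = 1 := by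
  have h := Finset.prod_univ_sum (fun _ : σ => (Finset.univ : Finset Bool))
    (fun i c => (if c then X i else 1 - X i : MvPolynomial σ R))
  rw [Fintype.piFinset_univ] at h
  simpa using h.symm

open MvPolynomial in
/-- An ideal containing the Boolean axioms contains every polynomial that vanishes on the
common roots of a generating set. -/
theorem mem_span_of_eval_eq_zero {F σ : Type*} [Field F] [Fintype σ]
    (P : Set (MvPolynomial σ F)) (hP : ∀ i, (X i ^ 2 - X i : MvPolynomial σ F) ∈ P)
    (q : MvPolynomial σ F) (hq : ∀ x : σ → F, (∀ p ∈ P, eval x p = 0) → eval x q = 0) :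
    q ∈ Ideal.span P := by
  classical
  have key := indicator_mul_sub_eval_mem (Ideal.span P) fun i => Ideal.subset_span (hP i)
  rw [← one_mul q, ← sum_indicator_eq_one, Finset.sum_mul]
  refine Ideal.sum_mem _ fun b _ => ?_
  by_cases hb : ∀ p ∈ P, eval (fun i => if b i then 1 else 0) p = 0
  · simpa [hq _ hb] using key b q
  · push Not at hb
    obtain ⟨p, hp, hne⟩ := hb
    refine Ideal.mul_mem_right _ _ ?_
    set D : MvPolynomial σ F := ∏ i, if b i then X i else 1 - X i
    set c := eval (fun i => if b i then 1 else 0) p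
    have hc : (C c * C c⁻¹ : MvPolynomial σ F) = 1 := by
      rw [← C_mul, mul_inv_cancel₀ hne, C_1]
    convert Ideal.mul_mem_left _ (C c⁻¹) ((Ideal.span P).sub_mem
      (Ideal.mul_mem_left _ D (Ideal.subset_span hp)) (key b p)) using 1
    linear_combination -D * hc

/-- **Boolean Nullstellensatz.** If a finite set `P` of polynomials over a field `F`
contains the Boolean axioms `x_i^2 - x_i`, then a polynomial `q` vanishes on all common
roots of `P` iff `q` lies in the ideal generated by `P`; in particular `1` lies in that
ideal iff the polynomials in `P` have no common root. -/
theorem boolean_nullstellensatz {F : Type*} [Field F] {n : ℕ}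
    (P : Finset (MvPolynomial (Fin n) F))
    (hP : ∀ i : Fin n, (MvPolynomial.X i ^ 2 - MvPolynomial.X i : MvPolynomial (Fin n) F) ∈ P) :
    (∀ q : MvPolynomial (Fin n) F,
        (∀ x : Fin n → F, (∀ p ∈ P, MvPolynomial.eval x p = 0) → MvPolynomial.eval x q = 0) ↔
          q ∈ Ideal.span (P : Set (MvPolynomial (Fin n) F))) ∧
      ((1 : MvPolynomial (Fin n) F) ∈ Ideal.span (P : Set (MvPolynomial (Fin n) F)) ↔
        ¬∃ x : Fin n → F, ∀ p ∈ P, MvPolynomial.eval x p = 0) := by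
  have main : ∀ q : MvPolynomial (Fin n) F,
      (∀ x : Fin n → F, (∀ p ∈ P, MvPolynomial.eval x p = 0) → MvPolynomial.eval x q = 0) ↔
        q ∈ Ideal.span (P : Set (MvPolynomial (Fin n) F)) := by
    refine fun q => ⟨mem_span_of_eval_eq_zero (P : Set (MvPolynomial (Fin n) F)) hP q, ?_⟩
    intro hq x hx
    have hle : Ideal.span (P : Set (MvPolynomial (Fin n) F)) ≤
        RingHom.ker (MvPolynomial.eval x) := Ideal.span_le.mpr hx
    exact hle hq
  refine ⟨main, ?_⟩
  rw [← main 1]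
  simp
end

section
/- Let F be a field, D a positive integer, and P a set of polynomials in F[x_1,...,x_n], and suppose there exists a degree-D pseudo-reduction operator R for P. Then P has no polynomial calculus refutation of degree at most D: for every finite sequence p_1,...,p_t of polynomials in F[x_1,...,x_n], each of degree at most D, such that each p_i either belongs to P, or equals a·p_j + b·p_k for some a, b in F and some j, k < i, or equals x_l·p_j for some variable x_l and some j < i, it holds that p_t ≠ 1. -/
open MvPolynomial in
/-- A linear operator satisfying `R (x_i * m) = R (x_i * R m)` on monomials `m` of degree at most
`k` satisfies it on all polynomials of total degree at most `k`. -/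
theorem map_X_mul_eq_of_totalDegree_le {F σ : Type*} [CommSemiring F] {k : ℕ}
    (R : MvPolynomial σ F →ₗ[F] MvPolynomial σ F) (i : σ)
    (hR : ∀ d : σ →₀ ℕ, (d.sum fun _ e => e) ≤ k →
      R (X i * monomial d 1) = R (X i * R (monomial d 1)))
    {q : MvPolynomial σ F} (hq : q.totalDegree ≤ k) :
    R (X i * q) = R (X i * R q) := by
  have h_sum : q = ∑ d ∈ q.support, coeff d q • monomial d (1 : F) := by
    conv_lhs => rw [q.as_sum]
    simp [smul_monomial]
  rw [h_sum]
  simp only [map_sum, map_smul, Finset.mul_sum, mul_smul_comm]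
  exact Finset.sum_congr rfl fun d hd => by rw [hR d ((le_totalDegree hd).trans hq)]

/-- If there exists a degree-`D` pseudo-reduction operator for `P`, then there is no
polynomial calculus refutation of `P` of degree at most `D`. -/
theorem pseudo_reduction_pc_degree_lower_bound {F : Type*} [Field F] {n : ℕ}
    (P : Set (MvPolynomial (Fin n) F)) (D : ℕ) (hD : 0 < D)
    (R : MvPolynomial (Fin n) F →ₗ[F] MvPolynomial (Fin n) F)
    (hR1 : R 1 = 1)
    (hR2 : ∀ p ∈ P, R p = 0)
    (hR3 : ∀ d : Fin n →₀ ℕ, (d.sum fun _ e => e) ≤ D - 1 → ∀ i : Fin n,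
      R (MvPolynomial.X i * MvPolynomial.monomial d 1) =
        R (MvPolynomial.X i * R (MvPolynomial.monomial d 1)))
    (t : ℕ) (p : Fin (t + 1) → MvPolynomial (Fin n) F)
    (hdeg : ∀ i, (p i).totalDegree ≤ D)
    (hderiv : ∀ i : Fin (t + 1),
      p i ∈ P ∨
      (∃ a b : F, ∃ j k : Fin (t + 1), j < i ∧ k < i ∧ p i = a • p j + b • p k) ∨
      (∃ l : Fin n, ∃ j : Fin (t + 1), j < i ∧ p i = MvPolynomial.X l * p j)) :
    p (Fin.last t) ≠ 1 := by
  have hR0 : ∀ i, R (p i) = 0 := by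
    intro i
    induction i using WellFoundedLT.induction with
    | ind i ih =>
      obtain hP | ⟨a, b, j, k, hj, hk, h⟩ | ⟨l, j, hj, h⟩ := hderiv i
      · exact hR2 _ hP
      · simp [h, ih j hj, ih k hk]
      · by_cases h0 : p j = 0
        · simp [h, h0]
        have hd := hdeg i
        rw [h, MvPolynomial.totalDegree_mul_of_isDomain (MvPolynomial.X_ne_zero l) h0,
          MvPolynomial.totalDegree_X] at hd
        rw [h, map_X_mul_eq_of_totalDegree_le R l (fun d hd => hR3 d hd l)
          (k := D - 1) (by omega), ih j hj, mul_zero, map_zero]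
  intro h
  have h1 := hR0 (Fin.last t)
  rw [h, hR1] at h1
  exact one_ne_zero h1
end

section
/- Let F be a field, ≺ an admissible order on the monomials of F[x_1,...,x_n], I an ideal of F[x_1,...,x_n], and p any polynomial in F[x_1,...,x_n]. Then there exists a unique polynomial r such that p - r belongs to I and every monomial occurring in r with nonzero coefficient is irreducible modulo I. -/
/-- An admissible order on the monomials (identified with their exponent vectors):
a total well-order such that `1 ≺ m` for every non-constant monomial `m`, compatible
with multiplication of monomials (addition of exponent vectors). -/
def IsAdmissibleOrder {σ : Type*} (r : (σ →₀ ℕ) → (σ →₀ ℕ) → Prop) : Prop :=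
  IsWellOrder (σ →₀ ℕ) r ∧ (∀ d : σ →₀ ℕ, d ≠ 0 → r 0 d) ∧
    ∀ d e m : σ →₀ ℕ, r d e → r (m + d) (m + e)

/-- `d` is the leading monomial of `p` with respect to the monomial order `r`. -/
def IsLeadingMonomialOf {σ F : Type*} [CommSemiring F]
    (r : (σ →₀ ℕ) → (σ →₀ ℕ) → Prop) (d : σ →₀ ℕ) (p : MvPolynomial σ F) : Prop :=
  d ∈ p.support ∧ ∀ e ∈ p.support, e ≠ d → r e d

/-- The monomial `d` is reducible modulo the ideal `I`: some nonzero `q ∈ I` has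
leading monomial `d`. -/
def Reducible {σ F : Type*} [CommSemiring F] (r : (σ →₀ ℕ) → (σ →₀ ℕ) → Prop)
    (I : Ideal (MvPolynomial σ F)) (d : σ →₀ ℕ) : Prop :=
  ∃ q ∈ I, q ≠ 0 ∧ IsLeadingMonomialOf r d q

/-- Every nonzero polynomial has a leading monomial with respect to a strict total order. -/
theorem exists_isLeadingMonomialOf {σ F : Type*} [CommSemiring F]
    (r : (σ →₀ ℕ) → (σ →₀ ℕ) → Prop) [IsStrictTotalOrder (σ →₀ ℕ) r]
    {p : MvPolynomial σ F} (hp : p ≠ 0) : ∃ d, IsLeadingMonomialOf r d p := by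
  have hwf : (p.support : Set (σ →₀ ℕ)).WellFoundedOn (Function.swap r) :=
    p.support.finite_toSet.wellFoundedOn
  have hne : p.support.Nonempty := MvPolynomial.support_nonempty.mpr hp
  obtain ⟨⟨d, hd⟩, -, hmin⟩ := WellFounded.has_min hwf Set.univ ⟨⟨_, hne.choose_spec⟩, trivial⟩
  refine ⟨d, hd, fun e he hed => ?_⟩
  rcases trichotomous_of r e d with h | h | h
  · exact h
  · exact absurd h hed
  · exact absurd h (hmin ⟨e, he⟩ trivial)

/-- The polynomials all of whose monomials are irreducible modulo `I` form a linear complement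
of `I`. -/
theorem isCompl_restrictSupport_not_reducible {σ F : Type*} [Field F]
    (r : (σ →₀ ℕ) → (σ →₀ ℕ) → Prop) [IsWellOrder (σ →₀ ℕ) r]
    (I : Ideal (MvPolynomial σ F)) :
    IsCompl (I.restrictScalars F)
      (MvPolynomial.restrictSupport F {d | ¬ Reducible r I d}) := by
  classical
  constructor
  · rw [Submodule.disjoint_def]
    intro p hpI hp
    by_contra hp0
    obtain ⟨d, hd⟩ := exists_isLeadingMonomialOf r hp0
    exact hp hd.1 ⟨p, hpI, hp0, hd⟩
  · set W := I.restrictScalars F ⊔ MvPolynomial.restrictSupport F {d | ¬ Reducible r I d}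
    have hmon (d : σ →₀ ℕ) : ∀ c : F, MvPolynomial.monomial d c ∈ W := by
      induction d using (IsWellFounded.wf : WellFounded r).induction with
      | _ d ih =>
      intro c
      by_cases hd : Reducible r I d
      · obtain ⟨q, hqI, -, hdq, hlt⟩ := hd
        have hc : q.coeff d ≠ 0 := MvPolynomial.mem_support_iff.mp hdq
        have hq : q ∈ W := Submodule.mem_sup_left hqI
        have hsum := q.support_sum_monomial_coeff
        rw [← Finset.add_sum_erase _ _ hdq] at hsum
        have htail : ∑ e ∈ q.support.erase d, MvPolynomial.monomial e (q.coeff e) ∈ W :=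
          Submodule.sum_mem _ fun e he =>
            ih e (hlt e (Finset.mem_of_mem_erase he) (Finset.ne_of_mem_erase he)) _
        have hlead : MvPolynomial.monomial d (q.coeff d) ∈ W := by
          rw [eq_sub_of_add_eq hsum]
          exact W.sub_mem hq htail
        have hscale := W.smul_mem (c / q.coeff d) hlead
        rwa [MvPolynomial.smul_monomial, smul_eq_mul, div_mul_cancel₀ c hc] at hscale
      · refine Submodule.mem_sup_right fun e he => ?_
        rwa [Finset.mem_singleton.mp (MvPolynomial.support_monomial_subset he)]
    rw [codisjoint_iff, Submodule.eq_top_iff']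
    intro p
    rw [← p.support_sum_monomial_coeff]
    exact W.sum_mem fun d _ => hmon d _

/-- **Existence and uniqueness of reduction modulo an ideal.** -/
theorem reduction_exists_unique {F : Type*} [Field F] {n : ℕ}
    (r : (Fin n →₀ ℕ) → (Fin n →₀ ℕ) → Prop) (hr : IsAdmissibleOrder r)
    (I : Ideal (MvPolynomial (Fin n) F)) (p : MvPolynomial (Fin n) F) :
    ∃! red : MvPolynomial (Fin n) F,
      p - red ∈ I ∧ ∀ d ∈ red.support, ¬ Reducible r I d := by
  have := hr.1
  have hcompl := isCompl_restrictSupport_not_reducible r I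
  obtain ⟨q, hq, red, hred, hsum⟩ :=
    Submodule.mem_sup.mp (hcompl.sup_eq_top ▸ Submodule.mem_top : p ∈ _ ⊔ _)
  refine ⟨red, ⟨eq_sub_of_add_eq hsum ▸ hq, fun d hd => hred hd⟩, ?_⟩
  rintro red' ⟨hI', hred'⟩
  refine sub_eq_zero.mp (Submodule.disjoint_def.mp hcompl.disjoint _ ?_
    (Submodule.sub_mem _ (fun d hd => hred' d hd) hred))
  have hmem := I.sub_mem hq hI'
  rw [← hsum] at hmem
  have hdiff : red' - red = q - (q + red - red') := by ring
  exact hdiff ▸ hmem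
end

section
/- Let F be a field, A and T finite sets, D a positive integer, P a set of polynomials in F[x_{A,T}] that contains the polynomial (Σ_{i∈T} x_{a,i}) - 1 for every a in A, and R a degree-D pseudo-reduction operator for P. Then for every subset Y of A with |Y| ≤ D-1, every function ψ: Y → T with R(m_ψ) ≠ 0, and every a in A \ Y, there exists i in T such that R(x_{a,i}·m_ψ) ≠ 0. -/
namespace MvPolynomial

/-- A linear operator with `R (x * m) = R (x * R m)` for monomials `m` of degree at most `k`
satisfies the same identity for all polynomials of total degree at most `k`. -/
theorem map_X_mul_of_totalDegree_le {F σ : Type*} [CommSemiring F] {k : ℕ}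
    (R : MvPolynomial σ F →ₗ[F] MvPolynomial σ F)
    (hR : ∀ d : σ →₀ ℕ, (d.sum fun _ e => e) ≤ k → ∀ v : σ,
      R (X v * monomial d 1) = R (X v * R (monomial d 1)))
    (q : MvPolynomial σ F) (hq : q.totalDegree ≤ k) (v : σ) :
    R (X v * q) = R (X v * R q) := by
  have hsum : q = ∑ d ∈ q.support, coeff d q • monomial d (1 : F) := by
    simp [smul_monomial]
  rw [hsum]
  simp only [Finset.mul_sum, map_sum, mul_smul_comm, map_smul]
  refine Finset.sum_congr rfl fun d hd => ?_
  rw [hR d ((le_totalDegree hd).trans hq) v]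

/-- If `R p = 0`, then `R` also kills the products of `p` with few variables. -/
theorem map_mul_prod_X_eq_zero {F σ ι : Type*} [CommSemiring F] [Nontrivial F] {k : ℕ}
    (R : MvPolynomial σ F →ₗ[F] MvPolynomial σ F)
    (hR : ∀ d : σ →₀ ℕ, (d.sum fun _ e => e) ≤ k → ∀ v : σ,
      R (X v * monomial d 1) = R (X v * R (monomial d 1)))
    (p : MvPolynomial σ F) (hp : R p = 0) (f : ι → σ) (s : Finset ι)
    (hs : p.totalDegree + s.card ≤ k + 1) :
    R (p * ∏ i ∈ s, X (f i)) = 0 := by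
  classical
  induction s using Finset.induction_on with
  | empty => simpa using hp
  | insert b s hb ih =>
    rw [Finset.card_insert_of_notMem hb] at hs
    have hprod : (∏ i ∈ s, (X (f i) : MvPolynomial σ F)).totalDegree ≤ s.card :=
      (totalDegree_finsetProd _ _).trans (by simp)
    have hdeg : (p * ∏ i ∈ s, X (f i)).totalDegree ≤ k := by
      have := totalDegree_mul p (∏ i ∈ s, X (f i))
      omega
    rw [Finset.prod_insert hb, mul_left_comm, map_X_mul_of_totalDegree_le R hR _ hdeg,
      ih (by omega), mul_zero, map_zero]

end MvPolynomial

/-- If `P` contains the polynomials `(Σ_{i∈T} x_{a,i}) - 1` and `R` is a degree-`D`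
pseudo-reduction operator for `P`, then every partial map `ψ : Y → T` with `R(m_ψ) ≠ 0`
and `|Y| ≤ D - 1` can be extended to any further vertex `a ∉ Y` while staying in the
support of `R`. -/
theorem pseudo_reduction_extendability {F A T : Type*} [Field F] [Fintype A] [Fintype T]
    [DecidableEq A]
    (D : ℕ) (hD : 0 < D)
    (P : Set (MvPolynomial (A × T) F))
    (hP : ∀ a : A, ((∑ i : T, MvPolynomial.X (a, i)) - 1 : MvPolynomial (A × T) F) ∈ P)
    (R : MvPolynomial (A × T) F →ₗ[F] MvPolynomial (A × T) F)
    (hR1 : R 1 = 1)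
    (hR2 : ∀ p ∈ P, R p = 0)
    (hR3 : ∀ d : A × T →₀ ℕ, (d.sum fun _ e => e) ≤ D - 1 → ∀ v : A × T,
      R (MvPolynomial.X v * MvPolynomial.monomial d 1) =
        R (MvPolynomial.X v * R (MvPolynomial.monomial d 1)))
    (Y : Finset A) (hY : Y.card ≤ D - 1)
    (ψ : A → T) (hψ : R (∏ a ∈ Y, MvPolynomial.X (a, ψ a)) ≠ 0)
    (a : A) (ha : a ∉ Y) :
    ∃ i : T, R (MvPolynomial.X (a, i) * ∏ b ∈ Y, MvPolynomial.X (b, ψ b)) ≠ 0 := by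
  by_contra! h
  have hdeg : ((∑ i : T, MvPolynomial.X (a, i)) - 1 : MvPolynomial (A × T) F).totalDegree ≤ 1 := by
    refine (MvPolynomial.totalDegree_sub _ _).trans (max_le ?_ (by simp))
    exact MvPolynomial.totalDegree_finsetSum_le fun i _ => by simp
  have hzero := MvPolynomial.map_mul_prod_X_eq_zero R hR3 _ (hR2 _ (hP a))
    (fun b => (b, ψ b)) Y (by omega)
  rw [sub_mul, one_mul, Finset.sum_mul, map_sub, map_sum, Finset.sum_eq_zero fun i _ => h i,
    zero_sub, neg_eq_zero] at hzero
  exact hψ hzero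
end

section
/- Let F be a field, A and T finite sets, D a positive integer, P a set of polynomials in F[x_{A,T}] that contains the polynomial (Σ_{i∈T} x_{a,i}) - 1 for every a in A, and R a degree-D pseudo-reduction operator for P. Then for every subset X of A with |X| ≤ D, the sum over all functions φ: X → T of R(m_φ) equals 1. -/
namespace MvPolynomial

theorem map_X_mul_eq_of_totalDegree_le {σ F : Type*} [CommSemiring F] {n : ℕ}
    {R : MvPolynomial σ F →ₗ[F] MvPolynomial σ F}
    (hR : ∀ d : σ →₀ ℕ, (d.sum fun _ e => e) ≤ n → ∀ v : σ,
      R (X v * monomial d 1) = R (X v * R (monomial d 1)))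
    {q : MvPolynomial σ F} (hq : q.totalDegree ≤ n) (v : σ) :
    R (X v * q) = R (X v * R q) := by
  have hsum : q = ∑ d ∈ q.support, q.coeff d • monomial d (1 : F) := by
    conv_lhs => rw [q.as_sum]
    simp [smul_monomial]
  rw [hsum]
  simp only [map_sum, map_smul, Finset.mul_sum, mul_smul_comm]
  exact Finset.sum_congr rfl fun d hd => by rw [hR d ((le_totalDegree hd).trans hq)]

theorem totalDegree_prod_sum_X_le {F A T : Type*} [CommSemiring F] [Fintype T]
    (S : Finset A) :
    (∏ a ∈ S, ∑ i : T, (X (a, i) : MvPolynomial (A × T) F)).totalDegree ≤ S.card := by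
  refine (totalDegree_finsetProd _ _).trans ?_
  rw [Finset.card_eq_sum_ones]
  refine Finset.sum_le_sum fun a _ => totalDegree_finsetSum_le fun i _ => ?_
  exact (totalDegree_monomial_le _ _).trans (by simp)

end MvPolynomial

/-- If `P` contains the polynomials `(Σ_{i∈T} x_{a,i}) - 1` and `R` is a degree-`D`
pseudo-reduction operator for `P`, then for every `X ⊆ A` with `|X| ≤ D`, the sum of
`R(m_φ)` over all functions `φ : X → T` equals `1`. -/
theorem pseudo_reduction_sum_one {F A T : Type*} [Field F] [Fintype A] [Fintype T]
    [DecidableEq A]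
    (D : ℕ) (hD : 0 < D)
    (P : Set (MvPolynomial (A × T) F))
    (hP : ∀ a : A, ((∑ i : T, MvPolynomial.X (a, i)) - 1 : MvPolynomial (A × T) F) ∈ P)
    (R : MvPolynomial (A × T) F →ₗ[F] MvPolynomial (A × T) F)
    (hR1 : R 1 = 1)
    (hR2 : ∀ p ∈ P, R p = 0)
    (hR3 : ∀ d : A × T →₀ ℕ, (d.sum fun _ e => e) ≤ D - 1 → ∀ v : A × T,
      R (MvPolynomial.X v * MvPolynomial.monomial d 1) =
        R (MvPolynomial.X v * R (MvPolynomial.monomial d 1)))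
    (X : Finset A) (hX : X.card ≤ D) :
    ∑ φ : (↥X → T), R (∏ a : ↥X, MvPolynomial.X ((a : A), φ a)) = 1 := by
  have hlin (a : A) : R (∑ i : T, MvPolynomial.X (a, i)) = 1 := by
    rw [← hR1, ← sub_eq_zero, ← map_sub, hR2 _ (hP a)]
  have hprod (S : Finset A) (hS : S.card ≤ D) :
      R (∏ a ∈ S, ∑ i : T, MvPolynomial.X (a, i)) = 1 := by
    induction S using Finset.induction_on with
    | empty => simpa using hR1
    | insert b S hb ih =>
      rw [Finset.card_insert_of_notMem hb] at hS
      have hdeg := (MvPolynomial.totalDegree_prod_sum_X_le (F := F) (T := T) S).trans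
        (Nat.le_sub_one_of_lt hS)
      rw [Finset.prod_insert hb, Finset.sum_mul, map_sum]
      simp_rw [MvPolynomial.map_X_mul_eq_of_totalDegree_le hR3 hdeg, ih (by omega), mul_one]
      rw [← map_sum, hlin]
  rw [← map_sum, ← hprod X hX, ← Finset.prod_coe_sort X, Finset.prod_univ_sum,
    Fintype.piFinset_univ]
end

section
/- Let F be a field, n a natural number, V a subset of {0,1}^n ⊆ F^n, S a subset of {1,...,n}, and for each i in S let f_i be a polynomial in the variables x_{i+1},...,x_n only, with all coefficients in the image of ℤ in F. Suppose that for every point a in V there exists i in S such that f_i(a_{i+1},...,a_n) = a_i. Then the polynomial p = Π_{i∈S} (x_i - f_i) vanishes at every point of V, has all coefficients in the image of ℤ in F, and its largest monomial with respect to the lexicographic order induced by x_1 ≻ x_2 ≻ ... ≻ x_n is Π_{i∈S} x_i, with coefficient 1. -/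
/-- The lexicographic order on monomials induced by `x_1 ≻ x_2 ≻ ... ≻ x_n`:
`d ≺ e` iff at the leftmost variable where they differ, `e` has the larger exponent. -/
def LexLtFin {n : ℕ} (d e : Fin n →₀ ℕ) : Prop :=
  ∃ v : Fin n, d v < e v ∧ ∀ w : Fin n, w < v → d w = e w

namespace MonomialOrder

variable {R : Type*} [CommRing R] [Nontrivial R] {σ : Type*} [LinearOrder σ] [WellFoundedGT σ]
  {i : σ} {f : MvPolynomial σ R}

/-- In the lexicographic order, a polynomial in variables smaller than `X i` has degree smaller
than that of `X i`. -/
theorem lex_degree_lt_degree_X (hf : ∀ j ∈ f.vars, i < j) :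
    lex.toSyn (lex.degree f) < lex.toSyn (lex.degree (MvPolynomial.X i : MvPolynomial σ R)) := by
  rw [degree_X, degree_lt_iff]
  · intro c hc
    have key : ∀ j ≤ i, c j = 0 := fun j hj =>
      MvPolynomial.mem_support_notMem_vars_zero hc fun h => (hf j h).not_ge hj
    rw [lex_lt_iff, Finsupp.Lex.lt_iff]
    refine ⟨i, fun j hj => ?_, ?_⟩
    · simp [key j hj.le, hj.ne']
    · simp [key i le_rfl]
  · rw [map_zero, toSyn_lt_iff_ne_zero, Ne, toSyn_eq_zero_iff]
    simp

theorem lex_degree_X_sub (hf : ∀ j ∈ f.vars, i < j) :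
    lex.degree (MvPolynomial.X i - f) = Finsupp.single i 1 := by
  rw [degree_sub_of_lt (lex_degree_lt_degree_X hf), degree_X]

theorem lex_monic_X_sub (hf : ∀ j ∈ f.vars, i < j) :
    lex.Monic (MvPolynomial.X i - f) := by
  rw [Monic, leadingCoeff_sub_of_lt (lex_degree_lt_degree_X hf), leadingCoeff_X]

end MonomialOrder

theorem MvPolynomial.mem_range_map_intCast_iff {R σ : Type*} [CommRing R] {p : MvPolynomial σ R} :
    p ∈ (MvPolynomial.map (σ := σ) (Int.castRingHom R)).range ↔
      ∀ e, p.coeff e ∈ Set.range (Int.cast : ℤ → R) := by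
  rw [← SetLike.mem_coe, RingHom.coe_range, MvPolynomial.mem_range_map_iff_coeffs_subset]
  refine ⟨fun h e => ?_, fun h c hc => ?_⟩
  · by_cases he : p.coeff e = 0
    · exact ⟨0, by simp [he]⟩
    · exact h (MvPolynomial.coeff_mem_coeffs e he)
  · obtain ⟨e, -, rfl⟩ := MvPolynomial.mem_coeffs_iff.1 hc
    exact h e

/-- Encoding of Lea's winning strategy as a polynomial: if for every `a ∈ V ⊆ {0,1}^n`
some `f_i` (a polynomial with integer coefficients in the variables `x_j`, `j > i`)
predicts `a_i`, then `p = Π_{i∈S} (x_i - f_i)` vanishes on `V`, has integer coefficients,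
and has leading monomial `Π_{i∈S} x_i` with coefficient `1` in the lexicographic order. -/
theorem strategy_polynomial {F : Type*} [Field F] {n : ℕ}
    (V : Set (Fin n → F)) (hV : ∀ x ∈ V, ∀ i : Fin n, x i = 0 ∨ x i = 1)
    (S : Finset (Fin n)) (f : Fin n → MvPolynomial (Fin n) F)
    (hvars : ∀ i ∈ S, ∀ j ∈ (f i).vars, i < j)
    (hint : ∀ i ∈ S, ∀ e : Fin n →₀ ℕ, (f i).coeff e ∈ Set.range (Int.cast : ℤ → F))
    (hwin : ∀ a ∈ V, ∃ i ∈ S, MvPolynomial.eval a (f i) = a i) :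
    (∀ a ∈ V, MvPolynomial.eval a (∏ i ∈ S, (MvPolynomial.X i - f i)) = 0) ∧
      (∀ e : Fin n →₀ ℕ,
        (∏ i ∈ S, (MvPolynomial.X i - f i)).coeff e ∈ Set.range (Int.cast : ℤ → F)) ∧
      (∏ i ∈ S, (MvPolynomial.X i - f i)).coeff (∑ i ∈ S, Finsupp.single i 1) = 1 ∧
      ∀ e ∈ (∏ i ∈ S, (MvPolynomial.X i - f i)).support,
        e ≠ ∑ i ∈ S, Finsupp.single i 1 → LexLtFin e (∑ i ∈ S, Finsupp.single i 1) := by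
  have hmonic : ∀ i ∈ S, MonomialOrder.lex.Monic (MvPolynomial.X i - f i) := fun i hi =>
    MonomialOrder.lex_monic_X_sub (hvars i hi)
  have hdeg : MonomialOrder.lex.degree (∏ i ∈ S, (MvPolynomial.X i - f i)) =
      ∑ i ∈ S, Finsupp.single i 1 := by
    rw [MonomialOrder.degree_prod fun i hi => (hmonic i hi).ne_zero]
    exact Finset.sum_congr rfl fun i hi => MonomialOrder.lex_degree_X_sub (hvars i hi)
  refine ⟨fun a ha => ?_, ?_, ?_, fun e he hne => ?_⟩
  · obtain ⟨i, hi, h⟩ := hwin a ha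
    rw [map_prod]
    exact Finset.prod_eq_zero hi (by simp [h])
  · rw [← MvPolynomial.mem_range_map_intCast_iff]
    exact prod_mem fun i hi => sub_mem ⟨MvPolynomial.X i, MvPolynomial.map_X _ i⟩
      (MvPolynomial.mem_range_map_intCast_iff.2 (hint i hi))
  · rw [← hdeg]
    exact MonomialOrder.Monic.prod hmonic
  · have hlt : toLex e < toLex (∑ i ∈ S, Finsupp.single i 1) := by
      refine lt_of_le_of_ne ?_ (toLex.injective.ne hne)
      rw [← MonomialOrder.lex_le_iff, ← hdeg]
      exact MonomialOrder.lex.le_degree he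
    rw [Finsupp.Lex.lt_iff] at hlt
    obtain ⟨v, hw, hv⟩ := hlt
    exact ⟨v, hv, hw⟩
end

section
/- Let G = (V, E) be a finite simple graph, s a natural number, and ε a real number with ε < 1/2. Suppose G is (s, ε)-sparse, that is, every vertex set U ⊆ V with |U| ≤ s spans at most (1+ε)·|U| edges in G. Then for every vertex set U ⊆ V with |U| ≤ s, the induced subgraph G[U] is properly 3-colorable. -/
open Classical in
/-- The degree-sum formula for the subgraph induced on a finite set of vertices. -/
theorem sum_card_neighbors_eq_two_mul_ncard_edges {V : Type*} [Fintype V]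
    (G : SimpleGraph V) (U : Finset V) :
    ∑ u ∈ U, (U.filter (G.Adj u)).card =
      2 * {e ∈ G.edgeSet | ∀ v ∈ e, v ∈ U}.ncard := by
  let H : SimpleGraph V :=
    { Adj := fun a b => G.Adj a b ∧ a ∈ U ∧ b ∈ U
      symm := ⟨fun _ _ h => ⟨h.1.symm, h.2.2, h.2.1⟩⟩
      loopless := ⟨fun _ h => h.1.ne rfl⟩ }
  have hedge : {e ∈ G.edgeSet | ∀ v ∈ e, v ∈ U} = (H.edgeFinset : Set (Sym2 V)) := by
    ext e
    induction e with
    | h a b => simp [H]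
  rw [hedge, Set.ncard_coe_finset, ← H.sum_degrees_eq_twice_card_edges,
    ← Finset.sum_subset (Finset.subset_univ U)]
  · refine Finset.sum_congr rfl fun u hu => ?_
    rw [← H.card_neighborFinset_eq_degree]
    congr 1
    ext v
    simp [H, hu, and_comm]
  · intro u _ hu
    rw [← H.card_neighborFinset_eq_degree, Finset.card_eq_zero]
    ext v
    simp [H, hu]

open Classical in
/-- Greedy coloring: a set of vertices all of whose nonempty subsets contain a vertex with fewer
than `k` neighbors in the subset can be properly colored with `k` colors. -/
theorem exists_coloring_of_forall_exists_card_neighbors_lt {V : Type*} (G : SimpleGraph V)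
    (k : ℕ) [NeZero k] (U : Finset V)
    (h : ∀ W ⊆ U, W.Nonempty → ∃ w ∈ W, (W.filter (G.Adj w)).card < k) :
    ∃ c : V → Fin k, ∀ u ∈ U, ∀ v ∈ U, G.Adj u v → c u ≠ c v := by
  induction U using Finset.strongInduction with
  | H U ih =>
    rcases U.eq_empty_or_nonempty with rfl | hne
    · exact ⟨fun _ => 0, by simp⟩
    obtain ⟨w, hw, hdeg⟩ := h U subset_rfl hne
    obtain ⟨c, hc⟩ := ih (U.erase w) (Finset.erase_ssubset hw)
      fun W hW => h W (hW.trans (Finset.erase_subset w U))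
    obtain ⟨x, -, hx⟩ : ∃ x ∈ (Finset.univ : Finset (Fin k)),
        x ∉ (U.filter (G.Adj w)).image c :=
      Finset.exists_mem_notMem_of_card_lt_card
        (by simpa using Finset.card_image_le.trans_lt hdeg)
    have hx' : ∀ v ∈ U, G.Adj w v → c v ≠ x := fun v hv hwv hvx =>
      hx (Finset.mem_image.2 ⟨v, Finset.mem_filter.2 ⟨hv, hwv⟩, hvx⟩)
    refine ⟨Function.update c w x, fun u hu v hv huv => ?_⟩
    by_cases huw : u = w
    · subst huw
      rw [Function.update_self, Function.update_of_ne huv.ne']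
      exact (hx' v hv huv).symm
    by_cases hvw : v = w
    · subst hvw
      rw [Function.update_self, Function.update_of_ne huw]
      exact hx' u hu huv.symm
    · rw [Function.update_of_ne huw, Function.update_of_ne hvw]
      exact hc u (Finset.mem_erase.2 ⟨huw, hu⟩) v (Finset.mem_erase.2 ⟨hvw, hv⟩) huv


/-- Every small set of vertices of an `(s, ε)`-sparse graph with `ε < 1/2` induces a
`3`-colorable subgraph. -/
theorem sparse_implies_locally_3_colorable {V : Type*} [Fintype V] [DecidableEq V]
    (G : SimpleGraph V) (s : ℕ) (ε : ℝ) (hε : ε < 1 / 2)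
    (hsparse : ∀ U : Finset V, U.card ≤ s →
      (({e ∈ G.edgeSet | ∀ v ∈ e, v ∈ U}.ncard : ℝ)) ≤ (1 + ε) * U.card)
    (U : Finset V) (hU : U.card ≤ s) :
    ∃ c : V → Fin 3, ∀ u ∈ U, ∀ v ∈ U, G.Adj u v → c u ≠ c v := by
  classical
  refine exists_coloring_of_forall_exists_card_neighbors_lt G 3 U fun W hW hne => ?_
  by_contra! hdeg
  have hlow : W.card * 3 ≤ 2 * {e ∈ G.edgeSet | ∀ v ∈ e, v ∈ W}.ncard := by
    rw [← sum_card_neighbors_eq_two_mul_ncard_edges]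
    exact W.card_nsmul_le_sum _ 3 hdeg
  have hup := hsparse W ((Finset.card_le_card hW).trans hU)
  have hpos : (0 : ℝ) < W.card := by exact_mod_cast hne.card_pos
  have hlow' : (W.card : ℝ) * 3 ≤ 2 * {e ∈ G.edgeSet | ∀ v ∈ e, v ∈ W}.ncard := by
    exact_mod_cast hlow
  nlinarith
end
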